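/- arXiv:2406.00206 — 4 statements merged into one kernel-verified Lean document; each statement's English description precedes it below -/
import Mathlib

section
/- Let p be a prime and s ≥ 1 a natural number. Let t ∈ ℤ_p with ‖t‖_p ≤ 1/p and set q = 1 + t. Then for every z ∈ ℤ_p one has ‖ ∏_{m=0}^{p^s−1} (1 − z·q^m) − ∏_{m=0}^{p^{s−1}−1} (1 − z^p·(q^p)^m) ‖_p ≤ p^{−s}; that is, the finite q-Pochhammer products satisfy the congruence (z;q)_{p^s} ≡ (z^p;q^p)_{p^{s−1}} (mod p^s) in ℤ_p. -/
/-- Splitting a product over `range (a * n)` into `n` consecutive blocks of length `a`. -/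
theorem prod_range_mul_eq_prod_blocks {M : Type*} [CommMonoid M] (f : ℕ → M) (a n : ℕ) :
    ∏ m ∈ Finset.range (a * n), f m =
      ∏ i ∈ Finset.range n, ∏ j ∈ Finset.range a, f (a * i + j) := by
  induction n with
  | zero => simp
  | succ n ih => rw [Nat.mul_succ, Finset.prod_range_add, ih, Finset.prod_range_succ]

theorem dvd_prod_range_sub_pow {R : Type*} [CommRing R] {d b : R} {f : ℕ → R}
    (h : ∀ i, d ∣ f i - b) (n : ℕ) : d ∣ (∏ i ∈ Finset.range n, f i) - b ^ n := by
  induction n with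
  | zero => simp
  | succ n ih =>
    obtain ⟨x, hx⟩ := ih
    obtain ⟨y, hy⟩ := h n
    rw [Finset.prod_range_succ]
    exact ⟨x * f n + b ^ n * y, by linear_combination f n * hx + b ^ n * hy⟩

/-- First-order expansion of a perturbed product whose factors and perturbations are constant
modulo `d`. -/
theorem mul_dvd_prod_add_mul_sub {R : Type*} [CommRing R] {d P b c : R} {f g : ℕ → R}
    (hP : d ∣ P) (hf : ∀ i, d ∣ f i - b) (hg : ∀ i, d ∣ g i - c) (n : ℕ) :
    d * P ∣ (∏ i ∈ Finset.range n, (f i + P * g i)) - ∏ i ∈ Finset.range n, f i -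
      n * (P * c * b ^ (n - 1)) := by
  induction n with
  | zero => simp
  | succ n ih =>
    obtain ⟨x, hx⟩ := ih
    obtain ⟨e, he⟩ := hP
    obtain ⟨y, hy⟩ := hf n
    obtain ⟨w, hw⟩ := hg n
    obtain ⟨v, hv⟩ := dvd_prod_range_sub_pow hf n
    have hn : (n : R) * b ^ (n - 1) * b = n * b ^ n := by
      cases n with
      | zero => simp
      | succ n => rw [Nat.add_sub_cancel, pow_succ]; ring
    rw [Finset.prod_range_succ, Finset.prod_range_succ, Nat.add_sub_cancel]
    push_cast
    refine ⟨x * (f n + P * g n) + n * c * b ^ (n - 1) * y + e * n * c * b ^ (n - 1) * g n +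
      v * g n + b ^ n * w, ?_⟩
    linear_combination (f n + P * g n) * hx + P * c * hn + n * P * c * b ^ (n - 1) * hy +
      P * n * c * b ^ (n - 1) * g n * he + P * g n * hv + P * b ^ n * hw

open Polynomial in
theorem dvd_comp_C_mul_X_sub {R : Type*} [CommRing R] {d u : R} (hu : d ∣ u - 1) (F : R[X]) :
    C d ∣ F.comp (C u * X) - F := by
  have h : C u * X - X ∣ F.comp (C u * X) - F.comp X := by
    simpa only [comp, eval₂_eq_eval_map] using sub_dvd_eval_sub (C u * X) X (F.map C)
  rw [comp_X] at h
  refine dvd_trans ?_ h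
  obtain ⟨e, he⟩ := hu
  exact ⟨C e * X, by rw [← mul_assoc, ← C_mul, ← he, C_sub, C_1]; ring⟩

theorem dvd_pow_sub_one {R : Type*} [CommRing R] {d q : R} (hq : d ∣ q - 1) (n : ℕ) :
    d ∣ q ^ n - 1 :=
  hq.trans (sub_one_dvd_pow_sub_one q n)

open Polynomial in
/-- Polynomials congruent modulo `p` have products congruent modulo `p ^ (k + 1)` along
the orbit of length `p ^ k` of a dilation `X ↦ q X` with `q ≡ 1` modulo `p`. -/
theorem pow_dvd_prod_comp_sub_prod_comp {R : Type*} [CommRing R] (p : ℕ) {q : R}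
    (hq : (p : R) ∣ q - 1) {A B : R[X]} (h : C (p : R) ∣ A - B) (k : ℕ) :
    C (p : R) ^ (k + 1) ∣ (∏ j ∈ Finset.range (p ^ k), A.comp (C (q ^ j) * X)) -
      ∏ j ∈ Finset.range (p ^ k), B.comp (C (q ^ j) * X) := by
  induction k with
  | zero => simpa using h
  | succ k ih =>
    obtain ⟨D, hD⟩ := ih
    have block (F : R[X]) : ∏ m ∈ Finset.range (p ^ (k + 1)), F.comp (C (q ^ m) * X) =
        ∏ i ∈ Finset.range p,
          (∏ j ∈ Finset.range (p ^ k), F.comp (C (q ^ j) * X)).comp (C (q ^ (p ^ k * i)) * X) := by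
      rw [pow_succ p k, prod_range_mul_eq_prod_blocks]
      refine Finset.prod_congr rfl fun i _ => ?_
      rw [prod_comp]
      refine Finset.prod_congr rfl fun j _ => ?_
      rw [comp_assoc, mul_comp, C_comp, X_comp, ← mul_assoc, ← C_mul, ← pow_add, add_comm]
    rw [block, block, sub_eq_iff_eq_add'.mp hD]
    simp only [add_comp, mul_comp, pow_comp, C_comp]
    have hdil (F : R[X]) (i : ℕ) : C (p : R) ∣ F.comp (C (q ^ (p ^ k * i)) * X) - F :=
      dvd_comp_C_mul_X_sub (dvd_pow_sub_one hq _) F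
    have key := mul_dvd_prod_add_mul_sub (dvd_pow_self (C (p : R)) k.succ_ne_zero)
      (hdil (∏ j ∈ Finset.range (p ^ k), B.comp (C (q ^ j) * X))) (hdil D) p
    rw [← pow_succ'] at key
    refine (dvd_iff_dvd_of_dvd_sub key).mpr ?_
    rw [← C_eq_natCast, mul_assoc (C (p : R) ^ _), ← mul_assoc, ← pow_succ']
    exact dvd_mul_right _ _

open Polynomial in
theorem prime_dvd_prod_one_sub_sub {R : Type*} [CommRing R] {p : ℕ} (hp : p.Prime) {w : R}
    (hw : (p : R) ∣ w - 1) :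
    C (p : R) ∣ (∏ i ∈ Finset.range p, (1 - C (w ^ i) * X)) - (1 - X ^ p) := by
  have h₁ : C (p : R) ∣ (∏ i ∈ Finset.range p, (1 - C (w ^ i) * X)) - (1 - X) ^ p := by
    refine dvd_prod_range_sub_pow (fun i => ?_) p
    obtain ⟨e, he⟩ := dvd_pow_sub_one hw i
    refine ⟨-(C e * X), ?_⟩
    have := congrArg C he
    simp only [C_sub, C_mul, C_1] at this
    linear_combination -X * this
  obtain ⟨r, hr⟩ := exists_add_pow_prime_eq hp (1 - X : R[X]) X
  obtain ⟨x, hx⟩ := h₁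
  rw [sub_add_cancel, one_pow] at hr
  rw [← C_eq_natCast] at hr
  exact ⟨x - (1 - X) * X * r, by linear_combination hx - hr⟩

/-- The congruence `(z; q)_{p^(k+1)} ≡ (z^p; q^p)_{p^k}` modulo `p^(k+1)` in any commutative ring
in which `q ≡ 1` modulo `p`. -/
theorem pow_dvd_qPochhammer_sub {R : Type*} [CommRing R] {p : ℕ} (hp : p.Prime) {q : R}
    (hq : (p : R) ∣ q - 1) (z : R) (k : ℕ) :
    (p : R) ^ (k + 1) ∣ (∏ m ∈ Finset.range (p ^ (k + 1)), (1 - z * q ^ m)) -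
      ∏ m ∈ Finset.range (p ^ k), (1 - z ^ p * (q ^ p) ^ m) := by
  have h := pow_dvd_prod_comp_sub_prod_comp p hq
    (prime_dvd_prod_one_sub_sub hp (dvd_pow_sub_one hq (p ^ k))) k
  have h' := map_dvd (Polynomial.evalRingHom z) h
  simp only [map_pow, map_sub, map_prod, Polynomial.coe_evalRingHom, Polynomial.eval_C,
    Polynomial.eval_comp, Polynomial.eval_prod, Polynomial.eval_sub, Polynomial.eval_one,
    Polynomial.eval_mul, Polynomial.eval_X, Polynomial.eval_pow] at h'
  convert h' using 2
  · rw [pow_succ p k, prod_range_mul_eq_prod_blocks, Finset.prod_comm]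
    refine Finset.prod_congr rfl fun j _ => Finset.prod_congr rfl fun i _ => ?_
    rw [pow_add, pow_mul]
    ring
  · refine Finset.prod_congr rfl fun j _ => ?_
    ring


/-- For a prime `p`, `s ≥ 1`, `t ∈ ℤ_p` with `‖t‖ ≤ 1/p` and `q = 1 + t`,
the finite `q`-Pochhammer products satisfy the congruence
`(z; q)_{p^s} ≡ (z^p; q^p)_{p^(s-1)} (mod p^s)` for every `z ∈ ℤ_p`. -/
theorem pochhammer_frobenius_congruence
    (p : ℕ) (hp : p.Prime) [Fact p.Prime] (s : ℕ) (hs : 1 ≤ s)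
    (t : ℤ_[p]) (ht : ‖t‖ ≤ (p : ℝ)⁻¹) (z : ℤ_[p]) :
    ‖(∏ m ∈ Finset.range (p ^ s), (1 - z * (1 + t) ^ m)) -
      ∏ m ∈ Finset.range (p ^ (s - 1)), (1 - z ^ p * ((1 + t) ^ p) ^ m)‖
      ≤ (p : ℝ) ^ (-(s : ℤ)) := by
  obtain ⟨k, rfl⟩ := Nat.exists_eq_add_of_le' hs
  have hq : (p : ℤ_[p]) ∣ (1 + t) - 1 := by
    rw [add_sub_cancel_left, ← pow_one (p : ℤ_[p]), ← Ideal.mem_span_singleton,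
      ← PadicInt.norm_le_pow_iff_mem_span_pow]
    simpa using ht
  rw [PadicInt.norm_le_pow_iff_mem_span_pow, Ideal.mem_span_singleton, Nat.add_sub_cancel]
  exact pow_dvd_qPochhammer_sub hp hq z k
end

section
/- Let p be a prime and s ≥ 1. Let t ∈ ℚ_p with 0 < ‖t‖_p ≤ 1/p, set q = 1 + t, and assume q^m ≠ 1 for every integer m ≥ 1. For i ∈ ℤ define R_s(i) = (∏_{m=1}^{p^s−1} (1 − q^{i+m})) / (∏_{m=1}^{p^s−1} (1 − q^m)) ∈ ℚ_p. Then: (a) if p does not divide i, ‖R_s(i)‖_p ≤ p^{−s}; (b) if p divides i, ‖R_s(i) − R'_{s−1}(i)‖_p ≤ p^{−s}, where R'_{s−1}(i) = (∏_{m=1}^{p^{s−1}−1} (1 − q^{i+pm})) / (∏_{m=1}^{p^{s−1}−1} (1 − q^{pm})). -/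
open Finset in
/-- Shifting the argument of a product of consecutive values of `f` by one. -/
theorem mul_prod_Icc_shift {M : Type*} [CommMonoid M] (f : ℤ → M) (i : ℤ) (N : ℕ) :
    f i * ∏ m ∈ Icc 1 N, f (i + (m : ℤ)) = (∏ m ∈ Icc 1 N, f (i - 1 + (m : ℤ))) * f (i + N) := by
  induction N with
  | zero => simp
  | succ N ih =>
    rw [prod_Icc_succ_top (by omega), prod_Icc_succ_top (by omega), ← mul_assoc, ih]
    congr 3
    push_cast
    ring

open Finset in
/-- Factoring a product over `1 ≤ m < p * M` whose factor is constant away from multiples of `p`. -/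
theorem prod_Icc_ite_dvd {R : Type*} [CommMonoid R] {p : ℕ} (hp : 0 < p) (M : ℕ) (f : ℕ → R)
    (c : R) :
    ∏ m ∈ Icc 1 (p * M - 1), (if p ∣ m then f m else c) =
      (∏ m ∈ Icc 1 (M - 1), f (p * m)) *
        c ^ #{m ∈ Icc 1 (p * M - 1) | ¬ p ∣ m} := by
  rw [prod_ite, prod_const]
  congr 1
  have himage : {m ∈ Icc 1 (p * M - 1) | p ∣ m} = (Icc 1 (M - 1)).image (p * ·) := by
    ext m
    simp only [mem_filter, mem_Icc, mem_image]
    constructor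
    · rintro ⟨⟨h1, h2⟩, k, rfl⟩
      have hk : k < M := Nat.lt_of_mul_lt_mul_left (a := p) (by omega)
      exact ⟨k, ⟨Nat.pos_of_ne_zero (by rintro rfl; simp at h1), by omega⟩, rfl⟩
    · rintro ⟨k, ⟨h1, h2⟩, rfl⟩
      have h3 : p * k < p * M := Nat.mul_lt_mul_of_pos_left (by omega) hp
      have h4 : 0 < p * k := Nat.mul_pos hp h1
      exact ⟨⟨by omega, by omega⟩, dvd_mul_right _ _⟩
  rw [himage, prod_image fun a _ b _ h => Nat.eq_of_mul_eq_mul_left hp h]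

section Ultrametric

variable {K : Type*} [NormedField K] [IsUltrametricDist K]

theorem norm_add_le_of_le_of_le {x y : K} {r : ℝ} (hx : ‖x‖ ≤ r) (hy : ‖y‖ ≤ r) : ‖x + y‖ ≤ r :=
  (IsUltrametricDist.norm_add_le_max x y).trans (max_le hx hy)

theorem norm_sub_le_of_forall_succ {f : ℤ → K} {r : ℝ} (hr : 0 ≤ r)
    (hf : ∀ i, ‖f i - f (i - 1)‖ ≤ r) (i : ℤ) : ‖f i - f 0‖ ≤ r := by
  induction i using Int.induction_on with
  | zero => simpa using hr
  | succ n ih =>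
    have h := norm_add_le_of_le_of_le (hf (n + 1)) (by simpa using ih)
    simpa using h
  | pred n ih =>
    have h := hf (-n)
    rw [norm_sub_rev] at h
    simpa using norm_add_le_of_le_of_le h ih

open Finset in
/-- Gaussian binomial coefficients are integral when `q` is a unit. -/
theorem norm_prod_div_prod_le_one {q : K} (hq1 : ‖q‖ = 1) (hq : ∀ m : ℕ, 1 ≤ m → q ^ m ≠ 1)
    (N : ℕ) (i : ℤ) :
    ‖(∏ m ∈ Icc 1 N, (1 - q ^ (i + (m : ℤ)))) / ∏ m ∈ Icc 1 N, (1 - q ^ (m : ℤ))‖ ≤ 1 := by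
  have hq0 : q ≠ 0 := norm_ne_zero_iff.1 (by simp [hq1])
  have hD (N : ℕ) : ∏ m ∈ Icc 1 N, (1 - q ^ (m : ℤ)) ≠ 0 := by
    refine prod_ne_zero_iff.2 fun m hm => sub_ne_zero.2 fun h => hq m (mem_Icc.1 hm).1 ?_
    rw [← zpow_natCast, ← h]
  induction N generalizing i with
  | zero => simp
  | succ N ih =>
    have hstep (i : ℤ) : ‖(∏ m ∈ Icc 1 (N + 1), (1 - q ^ (i + (m : ℤ)))) /
          (∏ m ∈ Icc 1 (N + 1), (1 - q ^ (m : ℤ))) -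
        (∏ m ∈ Icc 1 (N + 1), (1 - q ^ (i - 1 + (m : ℤ)))) /
          (∏ m ∈ Icc 1 (N + 1), (1 - q ^ (m : ℤ)))‖ ≤ 1 := by
      have hpascal : (∏ m ∈ Icc 1 (N + 1), (1 - q ^ (i + (m : ℤ)))) /
            (∏ m ∈ Icc 1 (N + 1), (1 - q ^ (m : ℤ))) -
          (∏ m ∈ Icc 1 (N + 1), (1 - q ^ (i - 1 + (m : ℤ)))) /
            (∏ m ∈ Icc 1 (N + 1), (1 - q ^ (m : ℤ))) =
          q ^ i * ((∏ m ∈ Icc 1 N, (1 - q ^ (i + (m : ℤ)))) /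
            ∏ m ∈ Icc 1 N, (1 - q ^ (m : ℤ))) := by
        have hshift := mul_prod_Icc_shift (fun n => 1 - q ^ n) i N
        have hlast := prod_Icc_succ_top (show 1 ≤ N + 1 by omega)
          fun m : ℕ => 1 - q ^ (i - 1 + (m : ℤ))
        rw [show i - 1 + ((N + 1 : ℕ) : ℤ) = i + N by push_cast; ring, ← hshift] at hlast
        have hden := prod_Icc_succ_top (show 1 ≤ N + 1 by omega) fun m : ℕ => 1 - q ^ (m : ℤ)
        have hDN := hD N
        have hDN' := hD (N + 1)
        rw [hlast, ← sub_div, div_eq_iff hDN', hden, prod_Icc_succ_top (by omega),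
          zpow_add₀ hq0 i]
        field_simp
        ring
      rw [hpascal, norm_mul, norm_zpow, hq1, one_zpow, one_mul]
      exact ih i
    have h := norm_sub_le_of_forall_succ zero_le_one hstep i
    have h1 := norm_add_le_of_le_of_le h
      (y := (∏ m ∈ Icc 1 (N + 1), (1 - q ^ ((0 : ℤ) + (m : ℤ)))) /
        ∏ m ∈ Icc 1 (N + 1), (1 - q ^ (m : ℤ))) (by simp only [zero_add]; rw [div_self (hD (N + 1)), norm_one])
    rwa [sub_add_cancel] at h1

theorem norm_one_sub_zpow_le {q : K} (hq1 : ‖q‖ = 1) (n : ℤ) : ‖1 - q ^ n‖ ≤ ‖1 - q‖ := by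
  have hq0 : q ≠ 0 := norm_ne_zero_iff.1 (by simp [hq1])
  have h := norm_sub_le_of_forall_succ (f := fun n : ℤ => q ^ n) (norm_nonneg (1 - q))
    (fun i => by
      have : q ^ i - q ^ (i - 1) = -(q ^ (i - 1) * (1 - q)) := by
        rw [zpow_sub_one₀ hq0]
        field_simp
        ring
      rw [this, norm_neg, norm_mul, norm_zpow, hq1, one_zpow, one_mul]) n
  simpa [norm_sub_rev] using h

end Ultrametric

section Padic

variable {p : ℕ} [Fact p.Prime]

theorem Padic.norm_one_sub_pow_prime_le {x : ℚ_[p]} (hx1 : ‖x‖ = 1)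
    (hx : ‖1 - x‖ ≤ (p : ℝ)⁻¹) : ‖1 - x ^ p‖ ≤ (p : ℝ)⁻¹ * ‖1 - x‖ := by
  rw [← mul_neg_geom_sum, norm_mul, mul_comm]
  gcongr
  have hsum : ∑ k ∈ Finset.range p, x ^ k = (p : ℚ_[p]) + ∑ k ∈ Finset.range p, (x ^ k - 1) := by
    simp
  rw [hsum]
  refine norm_add_le_of_le_of_le (by simp) ?_
  refine IsUltrametricDist.norm_sum_le_of_forall_le_of_nonneg (by positivity) fun k _ => ?_
  rw [norm_sub_rev]
  exact_mod_cast (norm_one_sub_zpow_le hx1 k).trans hx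

theorem Padic.norm_one_sub_pow_prime_pow_le {x : ℚ_[p]} (hx1 : ‖x‖ = 1)
    (hx : ‖1 - x‖ ≤ (p : ℝ)⁻¹) (s : ℕ) :
    ‖1 - x ^ (p ^ s)‖ ≤ (p : ℝ) ^ (-(s : ℤ)) * ‖1 - x‖ := by
  have hp0 : (p : ℝ) ≠ 0 := by exact_mod_cast (Fact.out : p.Prime).ne_zero
  induction s with
  | zero => simp
  | succ s ih =>
    have hle : ‖1 - x ^ (p ^ s)‖ ≤ (p : ℝ)⁻¹ :=
      le_trans (by exact_mod_cast norm_one_sub_zpow_le hx1 (p ^ s : ℕ)) hx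
    calc ‖1 - x ^ (p ^ (s + 1))‖ = ‖1 - (x ^ (p ^ s)) ^ p‖ := by rw [← pow_mul, pow_succ]
      _ ≤ (p : ℝ)⁻¹ * ‖1 - x ^ (p ^ s)‖ := norm_one_sub_pow_prime_le (by simp [hx1]) hle
      _ ≤ (p : ℝ)⁻¹ * ((p : ℝ) ^ (-(s : ℤ)) * ‖1 - x‖) := by gcongr
      _ = (p : ℝ) ^ (-((s + 1 : ℕ) : ℤ)) * ‖1 - x‖ := by
        rw [Nat.cast_succ, neg_add, zpow_add₀ hp0, zpow_neg_one]
        ring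

theorem Padic.norm_one_sub_zpow_eq {x : ℚ_[p]} (hx1 : ‖x‖ = 1)
    (hx : ‖1 - x‖ ≤ (p : ℝ)⁻¹) {n : ℤ} (hn : ¬ (p : ℤ) ∣ n) : ‖1 - x ^ n‖ = ‖1 - x‖ := by
  have hp : p.Prime := Fact.out
  have hx0 : x ≠ 0 := norm_ne_zero_iff.1 (by simp [hx1])
  refine (norm_one_sub_zpow_le hx1 n).antisymm ?_
  obtain ⟨a, b, hab⟩ := (Nat.prime_iff_prime_int.1 hp).coprime_iff_not_dvd.2 hn
  have hsplit : 1 - x = (1 - (x ^ n) ^ b) + x ^ (n * b) * (1 - (x ^ p) ^ a) := by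
    have hxn : x = x ^ (n * b) * (x ^ p) ^ a := by
      rw [← zpow_natCast x p, ← zpow_mul, ← zpow_add₀ hx0, show n * b + p * a = 1 by linarith,
        zpow_one]
    rw [← zpow_mul, mul_sub, ← hxn]
    ring
  have h1 : ‖1 - (x ^ n) ^ b‖ ≤ ‖1 - x ^ n‖ := norm_one_sub_zpow_le (by simp [hx1]) b
  have h2 : ‖x ^ (n * b) * (1 - (x ^ p) ^ a)‖ ≤ (p : ℝ)⁻¹ * ‖1 - x‖ := by
    rw [norm_mul, norm_zpow, hx1, one_zpow, one_mul]
    exact (norm_one_sub_zpow_le (by simp [hx1]) a).trans (norm_one_sub_pow_prime_le hx1 hx)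
  have hmax : ‖1 - x‖ ≤ max ‖1 - x ^ n‖ ((p : ℝ)⁻¹ * ‖1 - x‖) := by
    conv_lhs => rw [hsplit]
    exact (IsUltrametricDist.norm_add_le_max _ _).trans (max_le_max h1 h2)
  rcases le_max_iff.1 hmax with h | h
  · exact h
  · have hp1 : (p : ℝ)⁻¹ < 1 := inv_lt_one_of_one_lt₀ (by exact_mod_cast hp.one_lt)
    have : ‖1 - x‖ = 0 := by nlinarith [norm_nonneg (1 - x)]
    rw [this]
    exact norm_nonneg _

/-- The `q`-analogue `(1 - q ^ n) / (1 - q)` of `n`, with multiples of `p` replaced by `1`. -/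
noncomputable def Padic.qUnit (q : ℚ_[p]) (n : ℤ) : ℚ_[p] :=
  if (p : ℤ) ∣ n then 1 else (1 - q ^ n) / (1 - q)

theorem Padic.norm_qUnit {q : ℚ_[p]} (hq1 : ‖q‖ = 1) (hq : ‖1 - q‖ ≤ (p : ℝ)⁻¹)
    (hq0 : 1 - q ≠ 0) (n : ℤ) : ‖qUnit q n‖ = 1 := by
  unfold qUnit
  split_ifs with h
  · simp
  · rw [norm_div, norm_one_sub_zpow_eq hq1 hq h, div_self (norm_ne_zero_iff.2 hq0)]

theorem Padic.norm_qUnit_add_sub_le {q : ℚ_[p]} (hq1 : ‖q‖ = 1) (hq : ‖1 - q‖ ≤ (p : ℝ)⁻¹)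
    (hq0 : 1 - q ≠ 0) {s : ℕ} (hs : 1 ≤ s) (n : ℤ) :
    ‖qUnit q (n + (p ^ s : ℕ)) - qUnit q n‖ ≤ (p : ℝ) ^ (-(s : ℤ)) := by
  have hdvd : (p : ℤ) ∣ (p ^ s : ℕ) := by exact_mod_cast dvd_pow_self p (by omega)
  have hqz : q ≠ 0 := norm_ne_zero_iff.1 (by simp [hq1])
  unfold qUnit
  simp only [dvd_add_left hdvd]
  split_ifs with h
  · simp
  · have : (1 - q ^ (n + (p ^ s : ℕ))) / (1 - q) - (1 - q ^ n) / (1 - q) =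
        q ^ n * (1 - q ^ (p ^ s)) / (1 - q) := by
      rw [zpow_add₀ hqz, zpow_natCast]
      ring
    rw [this, norm_div, norm_mul, norm_zpow, hq1, one_zpow, one_mul,
      div_le_iff₀ (norm_pos_iff.2 hq0)]
    exact norm_one_sub_pow_prime_pow_le hq1 hq s

open Finset in
theorem Padic.norm_prod_qUnit_sub_le {q : ℚ_[p]} (hq1 : ‖q‖ = 1) (hq : ‖1 - q‖ ≤ (p : ℝ)⁻¹)
    (hq0 : 1 - q ≠ 0) {s : ℕ} (hs : 1 ≤ s) (i : ℤ) :
    ‖∏ m ∈ Icc 1 (p ^ s), qUnit q (i + (m : ℤ)) -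
      ∏ m ∈ Icc 1 (p ^ s), qUnit q ((0 : ℤ) + (m : ℤ))‖ ≤ (p : ℝ) ^ (-(s : ℤ)) := by
  refine norm_sub_le_of_forall_succ
    (f := fun i => ∏ m ∈ Icc 1 (p ^ s), qUnit q (i + (m : ℤ))) (by positivity) (fun i => ?_) i
  have hshift := mul_prod_Icc_shift (qUnit q) i (p ^ s)
  have hmul : qUnit q i * (∏ m ∈ Icc 1 (p ^ s), qUnit q (i + (m : ℤ)) -
      ∏ m ∈ Icc 1 (p ^ s), qUnit q (i - 1 + (m : ℤ))) =
      (∏ m ∈ Icc 1 (p ^ s), qUnit q (i - 1 + (m : ℤ))) *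
        (qUnit q (i + (p ^ s : ℕ)) - qUnit q i) := by
    rw [mul_sub, hshift]
    ring
  have hnorm := congrArg norm hmul
  simp only [norm_mul, norm_prod, norm_qUnit hq1 hq hq0, prod_const_one, one_mul] at hnorm
  rw [hnorm]
  exact norm_qUnit_add_sub_le hq1 hq hq0 hs i

open Finset in
/-- Separating the multiples of `p` in a product of `1 - q ^ (i + m)` when `p ∣ i`. -/
theorem Padic.prod_one_sub_zpow_eq {q : ℚ_[p]} (hq0 : 1 - q ≠ 0) {s : ℕ} (hs : 1 ≤ s) {i : ℤ}
    (hi : (p : ℤ) ∣ i) :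
    ∏ m ∈ Icc 1 (p ^ s - 1), (1 - q ^ (i + (m : ℤ))) =
      (∏ m ∈ Icc 1 (p ^ s), qUnit q (i + (m : ℤ))) *
        ((∏ m ∈ Icc 1 (p ^ (s - 1) - 1), (1 - q ^ (i + (p : ℤ) * (m : ℤ)))) *
          (1 - q) ^ #{m ∈ Icc 1 (p ^ s - 1) | ¬ p ∣ m}) := by
  have hp : p.Prime := Fact.out
  have hps : p * p ^ (s - 1) = p ^ s := by rw [← pow_succ', Nat.sub_add_cancel hs]
  have hlast : ∏ m ∈ Icc 1 (p ^ s), qUnit q (i + (m : ℤ)) =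
      ∏ m ∈ Icc 1 (p ^ s - 1), qUnit q (i + (m : ℤ)) := by
    obtain ⟨N, hN⟩ : ∃ N, p ^ s = N + 1 := ⟨p ^ s - 1, by have := pow_pos hp.pos s; omega⟩
    have hdvd : (p : ℤ) ∣ i + (p ^ s : ℕ) :=
      dvd_add hi (by exact_mod_cast dvd_pow_self p (by omega))
    rw [hN] at hdvd ⊢
    rw [prod_Icc_succ_top (by omega), Nat.add_sub_cancel]
    simp only [qUnit]
    rw [if_pos hdvd, mul_one]
  have hrest := prod_Icc_ite_dvd hp.pos (p ^ (s - 1)) (fun m => 1 - q ^ (i + (m : ℤ))) (1 - q)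
  rw [hps] at hrest
  push_cast at hrest
  rw [hlast, ← hrest, ← prod_mul_distrib]
  refine prod_congr rfl fun m _ => ?_
  have hiff : (p : ℤ) ∣ i + m ↔ p ∣ m := by rw [dvd_add_right hi, Int.natCast_dvd_natCast]
  unfold qUnit
  simp only [hiff]
  split_ifs with h
  · rw [one_mul]
  · rw [div_mul_cancel₀ _ hq0]

end Padic


/-- For a prime `p`, `s ≥ 1`, `q = 1 + t ∈ ℚ_p` with `0 < ‖t‖ ≤ 1/p` and
`q^m ≠ 1` for all `m ≥ 1`, the ratios
`R_s(i) = (∏_{m=1}^{p^s-1} (1 - q^(i+m))) / (∏_{m=1}^{p^s-1} (1 - q^m))` satisfy: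
(a) if `p ∤ i` then `‖R_s(i)‖ ≤ p^(-s)`;
(b) if `p ∣ i` then `‖R_s(i) - R'_{s-1}(i)‖ ≤ p^(-s)` where
`R'_{s-1}(i) = (∏_{m=1}^{p^(s-1)-1} (1 - q^(i+p*m))) / (∏_{m=1}^{p^(s-1)-1} (1 - q^(p*m)))`. -/
theorem qpochhammer_ratio_congruence
    (p : ℕ) (hp : p.Prime) [Fact p.Prime] (s : ℕ) (hs : 1 ≤ s)
    (t : ℚ_[p]) (ht0 : 0 < ‖t‖) (ht : ‖t‖ ≤ (p : ℝ)⁻¹)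
    (q : ℚ_[p]) (hqt : q = 1 + t)
    (hq : ∀ m : ℕ, 1 ≤ m → q ^ m ≠ 1) (i : ℤ) :
    (¬ (p : ℤ) ∣ i →
      ‖(∏ m ∈ Finset.Icc 1 (p ^ s - 1), (1 - q ^ (i + (m : ℤ)))) /
        (∏ m ∈ Finset.Icc 1 (p ^ s - 1), (1 - q ^ (m : ℤ)))‖ ≤ (p : ℝ) ^ (-(s : ℤ))) ∧
    ((p : ℤ) ∣ i →
      ‖(∏ m ∈ Finset.Icc 1 (p ^ s - 1), (1 - q ^ (i + (m : ℤ)))) /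
        (∏ m ∈ Finset.Icc 1 (p ^ s - 1), (1 - q ^ (m : ℤ))) -
       (∏ m ∈ Finset.Icc 1 (p ^ (s - 1) - 1), (1 - q ^ (i + (p : ℤ) * (m : ℤ)))) /
        (∏ m ∈ Finset.Icc 1 (p ^ (s - 1) - 1), (1 - q ^ ((p : ℤ) * (m : ℤ))))‖
        ≤ (p : ℝ) ^ (-(s : ℤ))) := by
  have hp1 : (p : ℝ)⁻¹ < 1 := inv_lt_one_of_one_lt₀ (by exact_mod_cast hp.one_lt)
  have hqt' : ‖1 - q‖ = ‖t‖ := by rw [hqt, sub_add_cancel_left, norm_neg]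
  have hq' : ‖1 - q‖ ≤ (p : ℝ)⁻¹ := hqt' ▸ ht
  have hne : 1 - q ≠ 0 := norm_pos_iff.1 (hqt' ▸ ht0)
  have hq1 : ‖q‖ = 1 := by
    have ht1 : ‖t‖ < ‖(1 : ℚ_[p])‖ := by rw [norm_one]; exact ht.trans_lt hp1
    rw [hqt, IsUltrametricDist.norm_add_eq_max_of_norm_ne_norm ht1.ne', max_eq_left ht1.le,
      norm_one]
  constructor
  · intro hi
    obtain ⟨N, hN⟩ : ∃ N, p ^ s = N + 1 := ⟨p ^ s - 1, by have := pow_pos hp.pos s; omega⟩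
    have hi1 : ‖1 - q ^ i‖ = ‖1 - q‖ := Padic.norm_one_sub_zpow_eq hq1 hq' hi
    have hps := Padic.norm_one_sub_pow_prime_pow_le hq1 hq' s
    have hN0 : 1 - q ^ (N + 1) ≠ 0 := sub_ne_zero.2 (hq (N + 1) (by omega)).symm
    have hint := norm_prod_div_prod_le_one hq1 hq (N + 1) (i - 1)
    rw [hN] at hps ⊢
    rw [Nat.add_sub_cancel]
    have hnum := Finset.prod_Icc_succ_top (show 1 ≤ N + 1 by omega)
      fun m : ℕ => 1 - q ^ (i - 1 + (m : ℤ))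
    have hshift := mul_prod_Icc_shift (fun n => 1 - q ^ n) i N
    rw [show i - 1 + ((N + 1 : ℕ) : ℤ) = i + N by push_cast; ring, ← hshift] at hnum
    rw [hnum, Finset.prod_Icc_succ_top (by omega), mul_comm, mul_div_mul_comm, norm_mul,
      norm_div (1 - q ^ i), hi1, zpow_natCast, ← mul_div_assoc,
      div_le_one (norm_pos_iff.2 hN0)] at hint
    exact le_of_mul_le_mul_right (hint.trans hps) (norm_pos_iff.2 hne)
  · intro hi
    have hP := Padic.norm_prod_qUnit_sub_le hq1 hq' hne hs i
    have hP0 : ‖∏ m ∈ Finset.Icc 1 (p ^ s), Padic.qUnit q ((0 : ℤ) + (m : ℤ))‖ = 1 := by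
      simp [norm_prod, Padic.norm_qUnit hq1 hq' hne, -zero_add]
    have hnum := Padic.prod_one_sub_zpow_eq hne hs hi
    have hden := Padic.prod_one_sub_zpow_eq hne hs (dvd_zero (p : ℤ))
    have hint : ‖(∏ m ∈ Finset.Icc 1 (p ^ (s - 1) - 1), (1 - q ^ (i + (p : ℤ) * (m : ℤ)))) /
        (∏ m ∈ Finset.Icc 1 (p ^ (s - 1) - 1), (1 - q ^ ((p : ℤ) * (m : ℤ))))‖ ≤ 1 := by
      obtain ⟨j, rfl⟩ := hi
      have h := norm_prod_div_prod_le_one (q := q ^ p) (by simp [hq1])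
        (fun m hm => by rw [← pow_mul]; exact hq _ (Nat.mul_pos hp.pos hm)) (p ^ (s - 1) - 1) j
      simpa only [← zpow_natCast q p, ← zpow_mul, mul_add] using h
    simp only [zero_add] at hden hP hP0
    rw [hnum, hden, mul_div_mul_comm, mul_div_mul_right _ _ (pow_ne_zero _ hne), ← sub_one_mul,
      norm_mul, div_sub_one (norm_ne_zero_iff.1 (by simp [hP0])), norm_div, hP0, div_one]
    exact (mul_le_of_le_one_right (norm_nonneg _) hint).trans hP
end

section
/- Let p be a prime, s ≥ 1, n ≥ 1, and let a_1, …, a_n, x ∈ ℤ. Let t ∈ ℚ_p with 0 < ‖t‖_p ≤ 1/p, set q = 1 + t, and assume q^m ≠ 1 for every integer m ≥ 1. For d ∈ ℕ define c_d = ∏_{i=1}^{n} (∏_{m=1}^{p^s−1} (1 − q^{p(x−a_i)+d+m})) / (∏_{m=1}^{p^s−1} (1 − q^m)) ∈ ℚ_p. Then: (a) if p does not divide d, ‖c_d‖_p ≤ p^{−s}; (b) if d = p·e for some e ∈ ℕ, then ‖c_d − c'_e‖_p ≤ p^{−s}, where c'_e = ∏_{i=1}^{n} (∏_{m=1}^{p^{s−1}−1}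 (1 − q^{p(x−a_i)+pe+pm})) / (∏_{m=1}^{p^{s−1}−1} (1 − q^{pm})). Equivalently, the normalized K-theoretic vertex functions satisfy the coefficient-wise congruence Ṽ(p·a, p·x, p^s, q, z) ≡ Ṽ(a, x, p^{s−1}, q^p, z^p) (mod p^s). -/
/-- The Gaussian binomial coefficient `[A + k choose k]_Q`, for an arbitrary integer `A`. -/
noncomputable def gaussBinom {K : Type*} [Field K] (Q : K) (k : ℕ) (A : ℤ) : K :=
  (∏ m ∈ Finset.Icc 1 k, (1 - Q ^ (A + (m : ℤ)))) / ∏ m ∈ Finset.Icc 1 k, (1 - Q ^ (m : ℤ))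

section Field

variable {K : Type*} [Field K] {Q : K}

theorem one_sub_zpow_natCast_ne_zero (hQ : ∀ m : ℕ, 1 ≤ m → Q ^ m ≠ 1) {m : ℕ} (hm : 1 ≤ m) :
    1 - Q ^ (m : ℤ) ≠ 0 := by
  rw [zpow_natCast]
  exact sub_ne_zero.2 (hQ m hm).symm

theorem prod_one_sub_zpow_ne_zero (hQ : ∀ m : ℕ, 1 ≤ m → Q ^ m ≠ 1) (k : ℕ) :
    ∏ m ∈ Finset.Icc 1 k, (1 - Q ^ (m : ℤ)) ≠ 0 :=
  Finset.prod_ne_zero_iff.2 fun _ hm =>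
    one_sub_zpow_natCast_ne_zero hQ (Finset.mem_Icc.1 hm).1

theorem gaussBinom_zero_left (A : ℤ) : gaussBinom Q 0 A = 1 := by
  simp [gaussBinom]

theorem gaussBinom_zero_right (hQ : ∀ m : ℕ, 1 ≤ m → Q ^ m ≠ 1) (k : ℕ) :
    gaussBinom Q k 0 = 1 := by
  simp only [gaussBinom, zero_add]
  exact div_self (prod_one_sub_zpow_ne_zero hQ k)

theorem gaussBinom_succ_mul (hQ : ∀ m : ℕ, 1 ≤ m → Q ^ m ≠ 1) (k : ℕ) (A : ℤ) :
    gaussBinom Q (k + 1) A * (1 - Q ^ ((k + 1 : ℕ) : ℤ)) =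
      gaussBinom Q k A * (1 - Q ^ (A + ((k + 1 : ℕ) : ℤ))) := by
  have h1 := prod_one_sub_zpow_ne_zero hQ k
  have h2 := one_sub_zpow_natCast_ne_zero hQ (Nat.succ_pos k)
  rw [gaussBinom, gaussBinom, Finset.prod_Icc_succ_top (by omega),
    Finset.prod_Icc_succ_top (by omega)]
  field_simp

theorem prod_one_sub_zpow_shift (k : ℕ) (A : ℤ) :
    ∏ m ∈ Finset.Icc 1 (k + 1), (1 - Q ^ (A - 1 + (m : ℤ))) =
      (1 - Q ^ A) * ∏ m ∈ Finset.Icc 1 k, (1 - Q ^ (A + (m : ℤ))) := by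
  induction k with
  | zero => simp
  | succ k ih =>
    rw [Finset.prod_Icc_succ_top (by omega), ih, Finset.prod_Icc_succ_top (by omega), mul_assoc]
    congr 4
    push_cast
    ring

/-- The `q`-Pascal rule. -/
theorem gaussBinom_succ (hQ0 : Q ≠ 0) (hQ : ∀ m : ℕ, 1 ≤ m → Q ^ m ≠ 1) (k : ℕ) (A : ℤ) :
    gaussBinom Q (k + 1) A =
      gaussBinom Q k A + Q ^ ((k + 1 : ℕ) : ℤ) * gaussBinom Q (k + 1) (A - 1) := by
  have h1 := prod_one_sub_zpow_ne_zero hQ k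
  have h2 := one_sub_zpow_natCast_ne_zero hQ (Nat.succ_pos k)
  rw [gaussBinom, gaussBinom, gaussBinom, prod_one_sub_zpow_shift,
    Finset.prod_Icc_succ_top (by omega), Finset.prod_Icc_succ_top (by omega), zpow_add₀ hQ0]
  generalize Q ^ ((k + 1 : ℕ) : ℤ) = u at *
  field_simp
  ring

end Field

theorem prod_Icc_eq_prod_multiples_mul {M : Type*} [CommMonoid M] {p N : ℕ} (hp : 0 < p)
    (hN : 0 < N) (f : ℕ → M) :
    ∏ m ∈ Finset.Icc 1 (p * N - 1), f m =
      (∏ m ∈ Finset.Icc 1 (N - 1), f (p * m)) *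
        ∏ m ∈ Finset.Icc 1 (p * N - 1), if p ∣ m then 1 else f m := by
  rw [← Finset.prod_filter_mul_prod_filter_not _ (fun m => p ∣ m) f, Finset.prod_ite,
    Finset.prod_const_one, one_mul]
  congr 1
  symm
  refine Finset.prod_nbij (fun m => p * m) ?_ ?_ ?_ fun _ _ => rfl
  · intro m hm
    simp only [Finset.mem_Icc, Finset.mem_filter, dvd_mul_right, and_true] at hm ⊢
    have h : p * m < p * N := Nat.mul_lt_mul_of_pos_left (by omega) hp
    have : 0 < p * m := Nat.mul_pos hp (by omega)
    omega
  · intro a _ b _ h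
    exact Nat.eq_of_mul_eq_mul_left hp h
  · intro m hm
    simp only [Finset.coe_filter, Finset.mem_Icc, Set.mem_ofPred_eq] at hm
    obtain ⟨⟨h1, h2⟩, c, rfl⟩ := hm
    refine ⟨c, ?_, rfl⟩
    have hc : c < N := Nat.lt_of_mul_lt_mul_left (a := p) (by omega)
    have hc0 : c ≠ 0 := by
      rintro rfl
      simp at h1
    simp only [Finset.coe_Icc, Set.mem_Icc]
    omega

section Ultrametric

variable {K : Type*} [NormedField K] [IsUltrametricDist K]

theorem norm_sub_le_of_both_le {a b : K} {r : ℝ} (ha : ‖a‖ ≤ r) (hb : ‖b‖ ≤ r) : ‖a - b‖ ≤ r := by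
  rw [sub_eq_add_neg]
  exact (IsUltrametricDist.norm_add_le_max a (-b)).trans (max_le ha ((norm_neg b).trans_le hb))

theorem norm_add_le_of_both_le {a b : K} {r : ℝ} (ha : ‖a‖ ≤ r) (hb : ‖b‖ ≤ r) : ‖a + b‖ ≤ r :=
  (IsUltrametricDist.norm_add_le_max a b).trans (max_le ha hb)

theorem norm_gaussBinom_le_one {Q : K} (hQ1 : ‖Q‖ = 1) (hQ : ∀ m : ℕ, 1 ≤ m → Q ^ m ≠ 1)
    (k : ℕ) (A : ℤ) : ‖gaussBinom Q k A‖ ≤ 1 := by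
  have hQ0 : Q ≠ 0 := by
    rintro rfl
    simp at hQ1
  induction k generalizing A with
  | zero => simp [gaussBinom_zero_left]
  | succ k ih =>
    have hmul (B : ℤ) : ‖Q ^ ((k + 1 : ℕ) : ℤ) * gaussBinom Q (k + 1) B‖ =
        ‖gaussBinom Q (k + 1) B‖ := by
      rw [norm_mul, norm_zpow, hQ1, one_zpow, one_mul]
    induction A using Int.induction_on with
    | zero => simp [gaussBinom_zero_right hQ]
    | succ i hi =>
      rw [gaussBinom_succ hQ0 hQ, add_sub_cancel_right]
      exact norm_add_le_of_both_le (ih _) ((hmul _).trans_le hi)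
    | pred i hi =>
      rw [← hmul, ← sub_eq_iff_eq_add'.2 (gaussBinom_succ hQ0 hQ k (-i))]
      exact norm_sub_le_of_both_le hi (ih _)

omit [IsUltrametricDist K] in
theorem norm_prod_le_one {ι : Type*} (S : Finset ι) {f : ι → K} (hf : ∀ i ∈ S, ‖f i‖ ≤ 1) :
    ‖∏ i ∈ S, f i‖ ≤ 1 := by
  rw [norm_prod]
  exact Finset.prod_le_one (fun _ _ => norm_nonneg _) hf

theorem norm_prod_sub_prod_le {ι : Type*} (S : Finset ι) {f g : ι → K} {r : ℝ} (hr : 0 ≤ r)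
    (hf : ∀ i ∈ S, ‖f i‖ ≤ 1) (hg : ∀ i ∈ S, ‖g i‖ ≤ 1) (hfg : ∀ i ∈ S, ‖f i - g i‖ ≤ r) :
    ‖∏ i ∈ S, f i - ∏ i ∈ S, g i‖ ≤ r := by
  classical
  induction S using Finset.induction_on with
  | empty => simpa using hr
  | insert j S hj ih =>
    simp only [Finset.forall_mem_insert] at hf hg hfg
    rw [Finset.prod_insert hj, Finset.prod_insert hj,
      show f j * ∏ i ∈ S, f i - g j * ∏ i ∈ S, g i =
        f j * (∏ i ∈ S, f i - ∏ i ∈ S, g i) + (f j - g j) * ∏ i ∈ S, g i by ring]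
    refine norm_add_le_of_both_le ?_ ?_
    · rw [norm_mul]
      exact (mul_le_of_le_one_left (norm_nonneg _) hf.1).trans (ih hf.2 hg.2 hfg.2)
    · rw [norm_mul]
      exact (mul_le_of_le_one_right (norm_nonneg _) (norm_prod_le_one S hg.2)).trans hfg.1

/-- The product of an almost `N`-periodic function over `N` consecutive integers hardly depends
on the starting point. -/
theorem norm_prod_range_shift_sub_le {h : ℤ → K} {N : ℕ} (hN : 0 < N) {r : ℝ} (hr : 0 ≤ r)
    (h1 : ∀ k, ‖h k‖ ≤ 1) (hper : ∀ k, ‖h (k + N) - h k‖ ≤ r) (C : ℤ) :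
    ‖∏ m ∈ Finset.range N, h (C + m) - ∏ m ∈ Finset.range N, h m‖ ≤ r := by
  obtain ⟨N, rfl⟩ : ∃ k, N = k + 1 := ⟨N - 1, by omega⟩
  have step (C : ℤ) : ‖∏ m ∈ Finset.range (N + 1), h (C + 1 + m) -
      ∏ m ∈ Finset.range (N + 1), h (C + m)‖ ≤ r := by
    rw [Finset.prod_range_succ, Finset.prod_range_succ']
    have e1 : ∀ m : ℕ, C + ((m + 1 : ℕ) : ℤ) = C + 1 + m := fun m => by push_cast; ring
    have e2 : C + 1 + (N : ℤ) = C + ((N + 1 : ℕ) : ℤ) := (e1 N).symm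
    simp only [e1]
    rw [Nat.cast_zero, add_zero, ← mul_sub, norm_mul]
    exact (mul_le_of_le_one_left (norm_nonneg _)
      (norm_prod_le_one _ fun _ _ => h1 _)).trans (e2 ▸ hper C)
  induction C using Int.induction_on with
  | zero => simpa using hr
  | succ i hi => simpa using norm_add_le_of_both_le (step i) hi
  | pred i hi =>
    have := norm_sub_le_of_both_le hi (step (-i - 1))
    simpa using this

end Ultrametric

section Padic

variable {p : ℕ} [Fact p.Prime] {q : ℚ_[p]}

theorem norm_eq_one_of_norm_sub_one_le (hq : ‖q - 1‖ ≤ (p : ℝ)⁻¹) : ‖q‖ = 1 := by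
  have hp : (p : ℝ)⁻¹ < 1 := inv_lt_one_of_one_lt₀ (mod_cast (Fact.out : p.Prime).one_lt)
  have h : ‖q - 1‖ < ‖(1 : ℚ_[p])‖ := by
    rw [norm_one]
    exact hq.trans_lt hp
  simpa using IsUltrametricDist.norm_add_eq_max_of_norm_ne_norm h.ne |>.trans
    (max_eq_right h.le)

theorem norm_pow_sub_one_le (hq : ‖q - 1‖ ≤ (p : ℝ)⁻¹) (k : ℕ) : ‖q ^ k - 1‖ ≤ ‖q - 1‖ := by
  rw [← mul_geom_sum, norm_mul]
  refine mul_le_of_le_one_right (norm_nonneg _) ?_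
  refine IsUltrametricDist.norm_sum_le_of_forall_le_of_nonneg zero_le_one fun i _ => ?_
  rw [norm_pow, norm_eq_one_of_norm_sub_one_le hq, one_pow]

theorem norm_geom_sum_sub_natCast_le (hq : ‖q - 1‖ ≤ (p : ℝ)⁻¹) (k : ℕ) :
    ‖∑ i ∈ Finset.range k, q ^ i - (k : ℚ_[p])‖ ≤ (p : ℝ)⁻¹ := by
  have : ∑ i ∈ Finset.range k, q ^ i - (k : ℚ_[p]) =
      ∑ i ∈ Finset.range k, (q ^ i - 1) := by simp
  rw [this]
  exact IsUltrametricDist.norm_sum_le_of_forall_le_of_nonneg (by positivity) fun i _ =>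
    (norm_pow_sub_one_le hq i).trans hq

theorem norm_pow_prime_pow_sub_one_le (hq : ‖q - 1‖ ≤ (p : ℝ)⁻¹) (s : ℕ) :
    ‖q ^ p ^ s - 1‖ ≤ (p : ℝ) ^ (-(s : ℤ)) * ‖q - 1‖ := by
  have hp : (0 : ℝ) < p := mod_cast (Fact.out : p.Prime).pos
  induction s with
  | zero => simp
  | succ s ih =>
    have hQ := (norm_pow_sub_one_le hq (p ^ s)).trans hq
    have hsum : ‖∑ i ∈ Finset.range p, (q ^ p ^ s) ^ i‖ ≤ (p : ℝ)⁻¹ := by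
      have := norm_add_le_of_both_le (norm_geom_sum_sub_natCast_le hQ p) (Padic.norm_p (p := p)).le
      simpa using this
    rw [pow_succ, pow_mul, ← mul_geom_sum, norm_mul]
    calc _ ≤ ((p : ℝ) ^ (-(s : ℤ)) * ‖q - 1‖) * (p : ℝ)⁻¹ := by gcongr
      _ = _ := by
        rw [show -((s + 1 : ℕ) : ℤ) = -(s : ℤ) + -1 by push_cast; ring, zpow_add₀ hp.ne',
          zpow_neg_one]
        ring

theorem norm_one_sub_zpow_natAbs (hq : ‖q - 1‖ ≤ (p : ℝ)⁻¹) (k : ℤ) :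
    ‖1 - q ^ k‖ = ‖q ^ k.natAbs - 1‖ := by
  have hq1 := norm_eq_one_of_norm_sub_one_le hq
  have hq0 : q ≠ 0 := by
    rintro rfl
    simp at hq1
  obtain h | h := Int.natAbs_eq k
  · rw [norm_sub_rev, ← zpow_natCast, ← h]
  · have : 1 - q ^ k = q ^ k * (q ^ k.natAbs - 1) := by
      rw [mul_sub, ← zpow_natCast, ← zpow_add₀ hq0, mul_one, show k + (k.natAbs : ℤ) = 0 by omega,
        zpow_zero]
    rw [this, norm_mul, norm_zpow, hq1, one_zpow, one_mul]

theorem norm_one_sub_zpow_eq (hq : ‖q - 1‖ ≤ (p : ℝ)⁻¹) {k : ℤ} (hk : ¬ (p : ℤ) ∣ k) :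
    ‖1 - q ^ k‖ = ‖q - 1‖ := by
  have hp : (p : ℝ)⁻¹ < 1 := inv_lt_one_of_one_lt₀ (mod_cast (Fact.out : p.Prime).one_lt)
  have hk1 : ‖(k.natAbs : ℚ_[p])‖ = 1 := by
    refine Padic.norm_natCast_eq_one_iff.2 ?_
    rw [Nat.Prime.coprime_iff_not_dvd Fact.out]
    rwa [← Int.natCast_dvd]
  have hlt : ‖∑ i ∈ Finset.range k.natAbs, q ^ i - (k.natAbs : ℚ_[p])‖ <
      ‖(k.natAbs : ℚ_[p])‖ := by
    rw [hk1]
    exact (norm_geom_sum_sub_natCast_le hq _).trans_lt hp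
  have hsum : ‖∑ i ∈ Finset.range k.natAbs, q ^ i‖ = 1 := by
    have := (IsUltrametricDist.norm_add_eq_max_of_norm_ne_norm hlt.ne).trans (max_eq_right hlt.le)
    rwa [sub_add_cancel, hk1] at this
  rw [norm_one_sub_zpow_natAbs hq, ← mul_geom_sum, norm_mul, hsum, mul_one]

/-- Modulo `p ^ s`, the `q`-binomial coefficient at a multiple of `p` reduces to a
`q ^ p`-binomial coefficient. -/
theorem norm_gaussBinom_sub_gaussBinom_le (hq : ‖q - 1‖ ≤ (p : ℝ)⁻¹)
    (hq' : ∀ m : ℕ, 1 ≤ m → q ^ m ≠ 1) (s : ℕ) (B : ℤ) :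
    ‖gaussBinom q (p ^ (s + 1) - 1) (p * B) - gaussBinom (q ^ p) (p ^ s - 1) B‖ ≤
      (p : ℝ) ^ (-((s + 1 : ℕ) : ℤ)) := by
  have hpp : p.Prime := Fact.out
  have hq1 := norm_eq_one_of_norm_sub_one_le hq
  have hq0 : q ≠ 0 := by
    rintro rfl
    simp at hq1
  have ht : q - 1 ≠ 0 := sub_ne_zero.2 (by simpa using hq' 1 le_rfl)
  have ht' : 0 < ‖q - 1‖ := norm_pos_iff.2 ht
  have hr : (0 : ℝ) ≤ (p : ℝ) ^ (-((s + 1 : ℕ) : ℤ)) := by positivity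
  have hQ' : ∀ m : ℕ, 1 ≤ m → (q ^ p) ^ m ≠ 1 := fun m hm => by
    rw [← pow_mul]
    exact hq' _ (Nat.mul_pos hpp.pos hm)
  set h : ℤ → ℚ_[p] := fun k => if (p : ℤ) ∣ k then 1 else (1 - q ^ k) / (q - 1) with hdef
  have hnorm (k : ℤ) : ‖h k‖ = 1 := by
    simp only [hdef]
    split_ifs with hk
    · exact norm_one
    · rw [norm_div, norm_one_sub_zpow_eq hq hk, div_self ht'.ne']
  have hper (k : ℤ) : ‖h (k + (p ^ (s + 1) : ℕ)) - h k‖ ≤ (p : ℝ) ^ (-((s + 1 : ℕ) : ℤ)) := by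
    have hdvd : (p : ℤ) ∣ k + (p ^ (s + 1) : ℕ) ↔ (p : ℤ) ∣ k := by
      refine dvd_add_left ?_
      push_cast
      exact dvd_pow_self _ s.succ_ne_zero
    simp only [hdef, hdvd]
    split_ifs with hk
    · simpa using hr
    · rw [← sub_div, norm_div, div_le_iff₀ ht', zpow_add₀ hq0, zpow_natCast,
        show 1 - q ^ k * q ^ p ^ (s + 1) - (1 - q ^ k) = -(q ^ k * (q ^ p ^ (s + 1) - 1)) by ring,
        norm_neg, norm_mul, norm_zpow, hq1, one_zpow, one_mul]
      exact norm_pow_prime_pow_sub_one_le hq (s + 1)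
  have hshift := norm_prod_range_shift_sub_le (pow_pos hpp.pos (s + 1)) hr
    (fun k => (hnorm k).le) hper (p * B)
  set H : ℤ → ℚ_[p] := fun C => ∏ m ∈ Finset.range (p ^ (s + 1)), h (C + m) with hH
  have hH0 : ‖H 0‖ = 1 := by simp [hH, norm_prod, hnorm]
  have hsplit (D : ℤ) : ∏ m ∈ Finset.Icc 1 (p ^ (s + 1) - 1), (1 - q ^ (p * D + (m : ℤ))) =
      (∏ m ∈ Finset.Icc 1 (p ^ s - 1), (1 - (q ^ p) ^ (D + (m : ℤ)))) *
        (H (p * D) * ∏ m ∈ Finset.Icc 1 (p ^ (s + 1) - 1), if p ∣ m then 1 else (q - 1)) := by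
    have hrange : H (p * D) = ∏ m ∈ Finset.Icc 1 (p ^ (s + 1) - 1), h (p * D + m) := by
      have hN := pow_pos hpp.pos (s + 1)
      have hz : h (p * D + (0 : ℕ)) = 1 := by simp [hdef]
      have hI : Finset.Icc 1 (p ^ (s + 1) - 1) = Finset.Ico (0 + 1) (p ^ (s + 1)) := by
        ext m
        simp only [Finset.mem_Icc, Finset.mem_Ico]
        omega
      simp only [hH]
      rw [hI, Finset.range_eq_Ico, Finset.prod_eq_prod_Ico_succ_bot hN, hz, one_mul]
    rw [hrange, ← Finset.prod_mul_distrib, pow_succ', prod_Icc_eq_prod_multiples_mul hpp.pos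
      (pow_pos hpp.pos s)]
    congr 1
    · refine Finset.prod_congr rfl fun m _ => ?_
      rw [← zpow_natCast q p, ← zpow_mul, mul_add, Nat.cast_mul]
    · refine Finset.prod_congr rfl fun m _ => ?_
      have hdvd : (p : ℤ) ∣ p * D + m ↔ p ∣ m := by
        rw [dvd_add_right (dvd_mul_right _ _), Int.natCast_dvd_natCast]
      simp only [hdef, hdvd]
      split_ifs
      · rw [mul_one]
      · rw [div_mul_cancel₀ _ ht]
  have hc : (∏ m ∈ Finset.Icc 1 (p ^ (s + 1) - 1), if p ∣ m then 1 else (q - 1)) ≠ 0 :=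
    Finset.prod_ne_zero_iff.2 fun m _ => by split_ifs <;> simp [ht]
  have hH0' : H 0 ≠ 0 := norm_pos_iff.1 (hH0 ▸ one_pos)
  have hX := prod_one_sub_zpow_ne_zero hQ' (p ^ s - 1)
  have hsplit0 := hsplit 0
  simp only [mul_zero, zero_add] at hsplit0
  have key : gaussBinom q (p ^ (s + 1) - 1) (p * B) - gaussBinom (q ^ p) (p ^ s - 1) B =
      gaussBinom (q ^ p) (p ^ s - 1) B * ((H (p * B) - H 0) / H 0) := by
    rw [gaussBinom, gaussBinom, hsplit, hsplit0]
    field_simp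
  rw [key, norm_mul, norm_div, hH0, div_one]
  refine (mul_le_of_le_one_left (norm_nonneg _)
    (norm_gaussBinom_le_one (by rw [norm_pow, hq1, one_pow]) hQ' _ _)).trans ?_
  simpa [hH] using hshift

/-- The `q`-binomial coefficient `[A + p ^ s - 1 choose p ^ s - 1]` is divisible by `p ^ s` when
`A` is prime to `p`. -/
theorem norm_gaussBinom_le_of_not_dvd (hq : ‖q - 1‖ ≤ (p : ℝ)⁻¹)
    (hq' : ∀ m : ℕ, 1 ≤ m → q ^ m ≠ 1) {s : ℕ} (hs : s ≠ 0) {A : ℤ} (hA : ¬ (p : ℤ) ∣ A) :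
    ‖gaussBinom q (p ^ s - 1) A‖ ≤ (p : ℝ) ^ (-(s : ℤ)) := by
  have hq1 := norm_eq_one_of_norm_sub_one_le hq
  have ht : 0 < ‖q - 1‖ := norm_pos_iff.2 (sub_ne_zero.2 (by simpa using hq' 1 le_rfl))
  have hN : p ^ s - 1 + 1 = p ^ s := Nat.sub_add_cancel (pow_pos (Fact.out : p.Prime).pos s)
  have hA' : ¬ (p : ℤ) ∣ A + (p ^ s : ℕ) := by
    rwa [dvd_add_left]
    push_cast
    exact dvd_pow_self _ hs
  have h := congrArg norm (gaussBinom_succ_mul hq' (p ^ s - 1) A)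
  rw [hN, norm_mul, norm_mul, norm_one_sub_zpow_eq hq hA', zpow_natCast,
    norm_sub_rev 1 (q ^ p ^ s)] at h
  refine le_of_mul_le_mul_right ?_ ht
  rw [← h]
  exact (mul_le_of_le_one_left (norm_nonneg _) (norm_gaussBinom_le_one hq1 hq' _ _)).trans
    (norm_pow_prime_pow_sub_one_le hq s)

end Padic

/-- coefficient-wise congruence for the normalized K-theoretic vertex
function of `T^*ℙ^(n-1)` at `h = p^s`:
`Ṽ(p·a, p·x, p^s, q, z) ≡ Ṽ(a, x, p^(s-1), q^p, z^p) (mod p^s)`.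
Concretely, with
`c_d = ∏_{i=1}^n (∏_{m=1}^{p^s-1} (1 - q^(p(x-a_i)+d+m))) / (∏_{m=1}^{p^s-1} (1 - q^m))`,
(a) if `p ∤ d` then `‖c_d‖ ≤ p^(-s)`;
(b) if `d = p·e` then `‖c_d - c'_e‖ ≤ p^(-s)` where
`c'_e = ∏_{i=1}^n (∏_{m=1}^{p^(s-1)-1} (1 - q^(p(x-a_i)+pe+pm))) / (∏_{m=1}^{p^(s-1)-1} (1 - q^(pm)))`. -/
theorem vertex_function_frobenius_congruence
    (p : ℕ) (hp : p.Prime) [Fact p.Prime] (s : ℕ) (hs : 1 ≤ s)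
    (n : ℕ) (hn : 1 ≤ n) (a : Fin n → ℤ) (x : ℤ)
    (t : ℚ_[p]) (ht0 : 0 < ‖t‖) (ht : ‖t‖ ≤ (p : ℝ)⁻¹)
    (q : ℚ_[p]) (hqt : q = 1 + t)
    (hq : ∀ m : ℕ, 1 ≤ m → q ^ m ≠ 1) (d : ℕ) :
    (¬ p ∣ d →
      ‖∏ i : Fin n,
          (∏ m ∈ Finset.Icc 1 (p ^ s - 1),
            (1 - q ^ ((p : ℤ) * (x - a i) + (d : ℤ) + (m : ℤ)))) /
          (∏ m ∈ Finset.Icc 1 (p ^ s - 1), (1 - q ^ (m : ℤ)))‖ ≤ (p : ℝ) ^ (-(s : ℤ))) ∧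
    (∀ e : ℕ, d = p * e →
      ‖(∏ i : Fin n,
          (∏ m ∈ Finset.Icc 1 (p ^ s - 1),
            (1 - q ^ ((p : ℤ) * (x - a i) + (d : ℤ) + (m : ℤ)))) /
          (∏ m ∈ Finset.Icc 1 (p ^ s - 1), (1 - q ^ (m : ℤ)))) -
       (∏ i : Fin n,
          (∏ m ∈ Finset.Icc 1 (p ^ (s - 1) - 1),
            (1 - q ^ ((p : ℤ) * (x - a i) + (p : ℤ) * (e : ℤ) + (p : ℤ) * (m : ℤ)))) /
          (∏ m ∈ Finset.Icc 1 (p ^ (s - 1) - 1), (1 - q ^ ((p : ℤ) * (m : ℤ)))))‖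
        ≤ (p : ℝ) ^ (-(s : ℤ))) := by
  have hqt' : ‖q - 1‖ ≤ (p : ℝ)⁻¹ := by rwa [hqt, add_sub_cancel_left]
  have hq1 := norm_eq_one_of_norm_sub_one_le hqt'
  have hint := norm_gaussBinom_le_one hq1 hq
  have hgauss (k : ℕ) (A : ℤ) : (∏ m ∈ Finset.Icc 1 k, (1 - q ^ (A + (m : ℤ)))) /
      (∏ m ∈ Finset.Icc 1 k, (1 - q ^ (m : ℤ))) = gaussBinom q k A := rfl
  simp only [hgauss]
  refine ⟨fun hd => ?_, ?_⟩
  · have i₀ : Fin n := ⟨0, hn⟩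
    have hA : ¬ (p : ℤ) ∣ p * (x - a i₀) + d := by
      rwa [dvd_add_right (dvd_mul_right _ _), Int.natCast_dvd_natCast]
    rw [← Finset.mul_prod_erase _ _ (Finset.mem_univ i₀), norm_mul]
    exact (mul_le_of_le_one_right (norm_nonneg _) (norm_prod_le_one _ fun _ _ => hint _ _)).trans
      (norm_gaussBinom_le_of_not_dvd hqt' hq (by omega) hA)
  · rintro e rfl
    obtain ⟨s, rfl⟩ : ∃ k, s = k + 1 := ⟨s - 1, by omega⟩
    have hQ1 : ‖q ^ p‖ = 1 := by rw [norm_pow, hq1, one_pow]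
    have hQ : ∀ m : ℕ, 1 ≤ m → (q ^ p) ^ m ≠ 1 := fun m hm => by
      rw [← pow_mul]
      exact hq _ (Nat.mul_pos hp.pos hm)
    simp only [Nat.cast_mul, ← mul_add, zpow_mul, zpow_natCast q p, Nat.add_sub_cancel]
    refine norm_prod_sub_prod_le _ (by positivity) (fun i _ => hint _ _)
      (fun i _ => norm_gaussBinom_le_one hQ1 hQ (p ^ s - 1) (x - a i + e)) fun i _ => ?_
    exact norm_gaussBinom_sub_gaussBinom_le hqt' hq s (x - a i + e)
end

section
/- Let R be a commutative ring, q ∈ R, p a prime, and let n ≥ 0 and h ≥ 1 be natural numbers. With the q-integers [i]_q = ∑_{k=0}^{i−1} q^k and q-factorials [m]_q! = ∏_{i=1}^{m} [i]_q, one has the identity [pn+ph−1]_q! · [n]_{q^p}! · [h−1]_{q^p}! · (∏_{0<i<pn, p∤i} [i]_q) · (∏_{0<i<ph, p∤i} [i]_q) = [n+h−1]_{q^p}! · [pn]_q! · [ph−1]_q! · (∏_{0<i<pn+ph, p∤i} [i]_q). (This is the identity of q-binomial coefficients binom(pn+ph−1, pn)_q / binom(n+h−1, n)_{q^p} = (∏_{0<i<pn+ph,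 p∤i}[i]_q) / ((∏_{0<i<pn, p∤i}[i]_q)(∏_{0<i<ph, p∤i}[i]_q)) with all denominators cleared.) -/
/-- The `q`-integer `[i]_q = ∑_{k=0}^{i-1} q^k`. -/
def qInt {R : Type*} [CommRing R] (q : R) (i : ℕ) : R :=
  ∑ k ∈ Finset.range i, q ^ k

/-- The `q`-factorial `[m]_q! = ∏_{i=1}^m [i]_q`. -/
def qFact {R : Type*} [CommRing R] (q : R) (m : ℕ) : R :=
  ∏ i ∈ Finset.Icc 1 m, qInt q i

/-- The product `∏_{0<i<N, p∤i} [i]_q`. -/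
def qGammaProd {R : Type*} [CommRing R] (q : R) (p N : ℕ) : R :=
  ∏ i ∈ (Finset.Ioo 0 N).filter (fun i => ¬ p ∣ i), qInt q i

theorem qInt_mul {R : Type*} [CommRing R] (q : R) (p i : ℕ) :
    qInt q (p * i) = qInt q p * qInt (q ^ p) i := by
  induction i with
  | zero => simp [qInt]
  | succ i ih =>
    unfold qInt at ih ⊢
    rw [Nat.mul_succ, Finset.sum_range_add, ih, Finset.sum_range_succ _ i, mul_add,
      Finset.sum_mul _ _ ((q ^ p) ^ i)]
    congr 1
    exact Finset.sum_congr rfl fun k _ => by ring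

theorem qFact_succ {R : Type*} [CommRing R] (q : R) (m : ℕ) :
    qFact q (m + 1) = qFact q m * qInt q (m + 1) :=
  Finset.prod_Icc_succ_top (by lia) _

theorem qFact_mul_succ_sub_one {R : Type*} [CommRing R] (q : R) {p : ℕ} (hp : 0 < p) (m : ℕ) :
    qFact q (p * (m + 1) - 1) =
      qGammaProd q p (p * (m + 1)) * (qInt q p ^ m * qFact (q ^ p) m) := by
  have hpos : 0 < p * (m + 1) := by positivity
  have hIcc : Finset.Icc 1 (p * (m + 1) - 1) = Finset.Ioo 0 (p * (m + 1)) := by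
    ext i
    simp only [Finset.mem_Icc, Finset.mem_Ioo]
    lia
  have hmul : (Finset.Ioo 0 (p * (m + 1))).filter (fun i => p ∣ i) =
      (Finset.Icc 1 m).image (p * ·) := by
    ext i
    simp only [Finset.mem_filter, Finset.mem_Ioo, Finset.mem_image, Finset.mem_Icc]
    constructor
    · rintro ⟨⟨h0, h1⟩, j, rfl⟩
      exact ⟨j, ⟨Nat.pos_of_mul_pos_left h0, Nat.lt_succ_iff.mp (Nat.lt_of_mul_lt_mul_left h1)⟩,
        rfl⟩
    · rintro ⟨j, ⟨h0, h1⟩, rfl⟩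
      exact ⟨⟨Nat.mul_pos hp h0, Nat.mul_lt_mul_of_pos_left (Nat.lt_succ_of_le h1) hp⟩,
        dvd_mul_right p j⟩
  have hdvd : ∏ i ∈ (Finset.Ioo 0 (p * (m + 1))).filter (fun i => p ∣ i), qInt q i =
      qInt q p ^ m * qFact (q ^ p) m := by
    rw [hmul, Finset.prod_image fun a _ b _ hab => Nat.eq_of_mul_eq_mul_left hp hab]
    simp only [qInt_mul, Finset.prod_mul_distrib, Finset.prod_const, Nat.card_Icc,
      Nat.add_sub_cancel, qFact]
  rw [← hdvd, qFact, hIcc, qGammaProd]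
  exact (Finset.prod_filter_not_mul_prod_filter _ (fun i => p ∣ i) (qInt q)).symm

theorem qFact_mul {R : Type*} [CommRing R] (q : R) {p : ℕ} (hp : 0 < p) (n : ℕ) :
    qFact q (p * n) = qGammaProd q p (p * n) * (qInt q p ^ n * qFact (q ^ p) n) := by
  cases n with
  | zero => simp [qFact, qGammaProd]
  | succ m =>
    have hpos : 0 < p * (m + 1) := by positivity
    have hsucc := qFact_succ q (p * (m + 1) - 1)
    rw [Nat.sub_add_cancel hpos] at hsucc
    rw [hsucc, qFact_mul_succ_sub_one q hp, qInt_mul, qFact_succ]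
    ring

/-- the denominator-cleared identity of `q`-binomial coefficients
`binom(pn+ph-1, pn)_q / binom(n+h-1, n)_{q^p}
  = (∏_{0<i<pn+ph, p∤i} [i]_q) / ((∏_{0<i<pn, p∤i} [i]_q)(∏_{0<i<ph, p∤i} [i]_q))`. -/
theorem qbinomial_gamma_identity {R : Type*} [CommRing R] (q : R)
    (p : ℕ) (hp : p.Prime) (n h : ℕ) (hh : 1 ≤ h) :
    qFact q (p * n + p * h - 1) * qFact (q ^ p) n * qFact (q ^ p) (h - 1) *
        qGammaProd q p (p * n) * qGammaProd q p (p * h) =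
      qFact (q ^ p) (n + h - 1) * qFact q (p * n) * qFact q (p * h - 1) *
        qGammaProd q p (p * n + p * h) := by
  obtain ⟨m, rfl⟩ := Nat.exists_eq_add_of_le' hh
  rw [← Nat.mul_add, ← Nat.add_assoc, qFact_mul_succ_sub_one q hp.pos,
    qFact_mul_succ_sub_one q hp.pos, qFact_mul q hp.pos, Nat.add_sub_cancel, Nat.add_sub_cancel]
  ring
end
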